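/- For every deterministic online algorithm A for OMSS(2,2) there exists an instance I such that the makespan of A's assignment on I is at least ((9+√17)/8)·OPT(I). In particular, no deterministic online algorithm for OMSS(2,2) is r-competitive for any r < (9+√17)/8. -/

import Mathlib

open Finset

/-- An instance of Online Makespan Scheduling under Scenarios with `K` scenarios:
`n` jobs `1,…,n`, nonnegative processing times `p`, and scenarios `S k ⊆ {1,…,n}`. -/
structure OMSSInstance (K : ℕ) where
  n : ℕ
  p : ℕ → ℝ
  hp : ∀ j, 0 ≤ p j
  S : Fin K → Finset ℕ
  hS : ∀ k, S k ⊆ Finset.Icc 1 n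

/-- A deterministic online algorithm for `OMSS(m,K)`: the machine for job `j` is a
function only of `j`, the processing times revealed so far, and the partial scenarios. -/
abbrev OnlineAlg (m K : ℕ) := ℕ → (ℕ → ℝ) → (Fin K → Finset ℕ) → Fin m

/-- The assignment produced by online algorithm `A` on instance `I`:
for job `j` the algorithm only sees `p_1,…,p_j` and `S_k ∩ [j]`. -/
noncomputable def algAssign {m K : ℕ} (A : OnlineAlg m K) (I : OMSSInstance K) : ℕ → Fin m :=
  fun j => A j (fun j' => if j' ≤ j then I.p j' else 0) (fun k => I.S k ∩ Finset.Icc 1 j)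

/-- Load of machine `i` in scenario `k` under assignment `τ`. -/
noncomputable def load {m K : ℕ} (I : OMSSInstance K) (τ : ℕ → Fin m) (i : Fin m)
    (k : Fin K) : ℝ :=
  ∑ j ∈ (I.S k).filter (fun j => τ j = i), I.p j

/-- Makespan of an assignment: the largest load of a machine in a scenario. -/
noncomputable def mkspan {m K : ℕ} (I : OMSSInstance K) (τ : ℕ → Fin m) : ℝ :=
  sSup {x | ∃ k : Fin K, ∃ i : Fin m, x = load I τ i k}

/-- Offline optimum makespan over all assignments to `m` machines. -/
noncomputable def OPT (m : ℕ) {K : ℕ} (I : OMSSInstance K) : ℝ :=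
  sInf {x | ∃ τ : ℕ → Fin m, x = mkspan I τ}

open scoped NNReal

/-- The instance whose jobs, given as pairs of a processing time and the set of scenarios
containing the job, are listed from the last one to the first one. -/
noncomputable def OMSSInstance.ofList {K : ℕ} : List (ℝ≥0 × Finset (Fin K)) → OMSSInstance K
  | [] => ⟨0, fun _ => 0, fun _ => le_rfl, fun _ => ∅, fun _ => Finset.empty_subset _⟩
  | x :: l =>
    { n := (ofList l).n + 1
      p := fun j => if j = (ofList l).n + 1 then (x.1 : ℝ) else (ofList l).p j
      hp := fun j => by
        split_ifs
        · exact x.1.2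
        · exact (ofList l).hp j
      S := fun k => if k ∈ x.2 then insert ((ofList l).n + 1) ((ofList l).S k) else (ofList l).S k
      hS := fun k => by
        have h := ((ofList l).hS k).trans (Finset.Icc_subset_Icc_right (Nat.le_succ _))
        split_ifs
        · exact Finset.insert_subset (by simp) h
        · exact h }

open OMSSInstance

section

variable {m K : ℕ} (x : ℝ≥0 × Finset (Fin K)) (l : List (ℝ≥0 × Finset (Fin K)))

theorem ofList_n : (ofList l).n = l.length := by
  induction l with
  | nil => rfl
  | cons x l ih => simp [ofList, ih]

theorem ofList_cons_p (j : ℕ) :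
    (ofList (x :: l)).p j = if j = l.length + 1 then (x.1 : ℝ) else (ofList l).p j := by
  simp [ofList, ofList_n]

theorem ofList_cons_S (k : Fin K) :
    (ofList (x :: l)).S k =
      if k ∈ x.2 then insert (l.length + 1) ((ofList l).S k) else (ofList l).S k := by
  simp [ofList, ofList_n]

theorem le_length_of_mem_ofList_S {k : Fin K} {j : ℕ} (hj : j ∈ (ofList l).S k) :
    j ≤ l.length := by
  have := (ofList l).hS k hj
  rw [ofList_n] at this
  exact (Finset.mem_Icc.1 this).2

theorem load_ofList_nil (τ : ℕ → Fin m) (i : Fin m) (k : Fin K) :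
    load (ofList []) τ i k = 0 := by
  simp [load, ofList]

theorem load_ofList_cons (τ : ℕ → Fin m) (i : Fin m) (k : Fin K) :
    load (ofList (x :: l)) τ i k =
      (if k ∈ x.2 ∧ τ (l.length + 1) = i then (x.1 : ℝ) else 0) + load (ofList l) τ i k := by
  have hn : l.length + 1 ∉ (ofList l).S k := fun h => by
    have := le_length_of_mem_ofList_S l h
    omega
  have hsum : ∑ j ∈ (ofList l).S k with τ j = i, (ofList (x :: l)).p j
      = ∑ j ∈ (ofList l).S k with τ j = i, (ofList l).p j := by
    refine Finset.sum_congr rfl fun j hj => ?_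
    rw [ofList_cons_p, if_neg]
    rintro rfl
    exact hn (Finset.mem_filter.1 hj).1
  unfold load
  rw [ofList_cons_S]
  by_cases hk : k ∈ x.2
  · by_cases hi : τ (l.length + 1) = i
    · rw [if_pos hk, Finset.filter_insert, if_pos hi, Finset.sum_insert (by simp [hn]), hsum,
        ofList_cons_p]
      simp [hk, hi]
    · rw [if_pos hk, Finset.filter_insert, if_neg hi, hsum]
      simp [hi]
  · rw [if_neg hk, hsum]
    simp [hk]

theorem algAssign_ofList_cons (A : OnlineAlg m K) {j : ℕ} (hj : j ≤ l.length) :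
    algAssign A (ofList (x :: l)) j = algAssign A (ofList l) j := by
  unfold algAssign
  congr 1
  · funext i
    rw [ofList_cons_p]
    split_ifs <;> first | rfl | omega
  · funext k
    rw [ofList_cons_S]
    split_ifs
    · rw [Finset.insert_inter_of_notMem]
      simp only [Finset.mem_Icc]
      omega
    · rfl

theorem load_congr (I : OMSSInstance K) {τ σ : ℕ → Fin m} (i : Fin m) (k : Fin K)
    (h : ∀ j ∈ I.S k, τ j = σ j) : load I τ i k = load I σ i k := by
  unfold load
  rw [Finset.filter_congr fun j hj => by rw [h j hj]]

theorem load_algAssign_ofList_cons (A : OnlineAlg m K) (i : Fin m) (k : Fin K) :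
    load (ofList (x :: l)) (algAssign A (ofList (x :: l))) i k =
      (if k ∈ x.2 ∧ algAssign A (ofList (x :: l)) (l.length + 1) = i then (x.1 : ℝ) else 0) +
        load (ofList l) (algAssign A (ofList l)) i k := by
  rw [load_ofList_cons, load_congr (ofList l) i k fun j hj =>
    algAssign_ofList_cons x l A (le_length_of_mem_ofList_S l hj)]

theorem load_nonneg (I : OMSSInstance K) (τ : ℕ → Fin m) (i : Fin m) (k : Fin K) :
    0 ≤ load I τ i k :=
  Finset.sum_nonneg fun j _ => I.hp j

theorem load_le_mkspan (I : OMSSInstance K) (τ : ℕ → Fin m) (i : Fin m) (k : Fin K) :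
    load I τ i k ≤ mkspan I τ := by
  refine le_csSup (Set.Finite.bddAbove ?_) ⟨k, i, rfl⟩
  refine (Set.finite_range fun q : Fin K × Fin m => load I τ q.2 q.1).subset ?_
  rintro _ ⟨k, i, rfl⟩
  exact ⟨(k, i), rfl⟩

theorem mkspan_nonneg (I : OMSSInstance K) (τ : ℕ → Fin m) : 0 ≤ mkspan I τ := by
  refine Real.sSup_nonneg ?_
  rintro _ ⟨k, i, rfl⟩
  exact load_nonneg I τ i k

theorem OPT_le_of_load_le (I : OMSSInstance K) (τ : ℕ → Fin m) {v : ℝ} (hv : 0 ≤ v)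
    (h : ∀ i k, load I τ i k ≤ v) : OPT m I ≤ v := by
  have hbdd : BddBelow {x | ∃ τ : ℕ → Fin m, x = mkspan I τ} := by
    refine ⟨0, ?_⟩
    rintro _ ⟨σ, rfl⟩
    exact mkspan_nonneg I σ
  refine (csInf_le hbdd ⟨τ, rfl⟩).trans (Real.sSup_le ?_ hv)
  · rintro _ ⟨k, i, rfl⟩
    exact h i k

theorem le_OPT_of_mem [NeZero m] (I : OMSSInstance K) {k : Fin K} {j : ℕ} (hj : j ∈ I.S k) :
    I.p j ≤ OPT m I := by
  refine le_csInf ⟨_, fun _ => 0, rfl⟩ ?_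
  rintro _ ⟨τ, rfl⟩
  refine le_trans ?_ (load_le_mkspan I τ (τ j) k)
  exact Finset.single_le_sum (f := I.p) (fun i _ => I.hp i) (by simp [hj])

end

/-- The adversary: two unit jobs in both scenarios, then jobs of sizes `y` and `2 * y` in one
scenario each. If the algorithm puts the last two on the same machine, a job of size `2 * y` in
the first scenario follows, otherwise a job of size `y` in both; a job of size `2 + 3 * y` in both
scenarios concludes. -/
theorem exists_OPT_pos_and_mul_OPT_le_mkspan (A : OnlineAlg 2 2) :
    ∃ I : OMSSInstance 2, 0 < OPT 2 I ∧
      ((9 + Real.sqrt 17) / 8) * OPT 2 I ≤ mkspan I (algAssign A I) := by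
  by_contra! H
  obtain ⟨s, hs⟩ : ∃ s, s = Real.sqrt 17 := ⟨_, rfl⟩
  rw [← hs] at H
  have hs0 : 0 ≤ s := hs ▸ Real.sqrt_nonneg _
  have hss : s * s = 17 := hs ▸ Real.mul_self_sqrt (by norm_num)
  have hs4 : 4 < s := by nlinarith
  have hs5 : s < 5 := by nlinarith
  clear hs
  obtain ⟨y, hy⟩ : ∃ y : ℝ≥0, (y : ℝ) = (s + 3) / 2 := ⟨⟨(s + 3) / 2, by linarith⟩, rfl⟩
  have key (l : List (ℝ≥0 × Finset (Fin 2))) (τ : ℕ → Fin 2) (v : ℝ) (hv : 0 ≤ v)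
      (h1 : 1 ∈ (ofList l).S 0) (hp : (ofList l).p 1 = 1)
      (hτ : ∀ i k, load (ofList l) τ i k ≤ v) (i k : Fin 2) :
      load (ofList l) (algAssign A (ofList l)) i k < (9 + s) / 8 * v := by
    have h := H (ofList l) (by linarith [le_OPT_of_mem (m := 2) (ofList l) h1])
    have h' := OPT_le_of_load_le (ofList l) τ hv hτ
    exact (load_le_mkspan _ _ i k).trans_lt
      (h.trans_le (mul_le_mul_of_nonneg_left h' (by linarith)))
  have e1 : (9 + s) / 8 * (2 * y) = (11 + 3 * s) / 2 := by rw [hy]; linarith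
  have e2 : (9 + s) / 8 * (2 + 3 * y) = (21 + 5 * s) / 2 := by rw [hy]; linarith
  have fin2 (d : Fin 2) : d = 0 ∨ d = 1 := by omega
  let l2 : List (ℝ≥0 × Finset (Fin 2)) := [(1, univ), (1, univ)]
  let l4 := (2 * y, {1}) :: (y, {0}) :: l2
  let l5 := (2 * y, {0}) :: l4
  let l5' := (y, univ) :: l4
  let l6 := (2 + 3 * y, univ) :: l5
  let l6' := (2 + 3 * y, univ) :: l5'
  have k2 := key l2 (fun j => if j = 1 then 0 else 1) 1 (by norm_num)
    (by simp [l2, ofList_cons_S]) (by simp [l2, ofList_cons_p])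
    (by simp [l2, Fin.forall_fin_two, load_ofList_cons, load_ofList_nil])
  have k5 := key l5 (fun j => if j = 5 then 0 else if j = 4 then 0 else 1) (2 * y) (by positivity)
    (by simp [l5, l4, l2, ofList_cons_S]) (by simp [l5, l4, l2, ofList_cons_p])
    (by simp [l5, l4, l2, Fin.forall_fin_two, load_ofList_cons, load_ofList_nil]; grind)
  have k5' := key l5' (fun j => if j = 3 then 0 else if j = 4 then 0 else 1) (2 * y)
    (by positivity)
    (by simp [l5', l4, l2, ofList_cons_S]) (by simp [l5', l4, l2, ofList_cons_p])
    (by simp [l5', l4, l2, Fin.forall_fin_two, load_ofList_cons, load_ofList_nil]; grind)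
  have k6 := key l6 (fun j => if j = 6 then 0 else 1) (2 + 3 * y) (by positivity)
    (by simp [l6, l5, l4, l2, ofList_cons_S]) (by simp [l6, l5, l4, l2, ofList_cons_p])
    (by simp [l6, l5, l4, l2, Fin.forall_fin_two, load_ofList_cons, load_ofList_nil]; grind)
  have k6' := key l6' (fun j => if j = 6 then 0 else 1) (2 + 3 * y) (by positivity)
    (by simp [l6', l5', l4, l2, ofList_cons_S]) (by simp [l6', l5', l4, l2, ofList_cons_p])
    (by simp [l6', l5', l4, l2, Fin.forall_fin_two, load_ofList_cons, load_ofList_nil]; grind)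
  rw [e1] at k5 k5'
  rw [e2] at k6 k6'
  simp only [l6, l6', l5, l5', l4, l2, Fin.forall_fin_two, load_algAssign_ofList_cons,
    load_ofList_nil, List.length_cons, List.length_nil, Finset.mem_univ, Finset.mem_singleton,
    NNReal.coe_add, NNReal.coe_mul, NNReal.coe_one, NNReal.coe_ofNat, hy,
    zero_add, Nat.reduceAdd] at k2 k5 k5' k6 k6'
  clear H key e1 e2
  generalize algAssign A _ 1 = d₁ at *
  generalize algAssign A _ 2 = d₂ at *
  generalize algAssign A _ 3 = d₃ at *
  generalize algAssign A _ 4 = d₄ at *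
  generalize algAssign A (ofList ((_, {0}) :: _)) 5 = d₅ at *
  generalize algAssign A _ 5 = d₅' at *
  generalize algAssign A (ofList (_ :: (_, {0}) :: _)) 6 = d₆ at *
  generalize algAssign A _ 6 = d₆' at *
  have hne : d₂ ≠ d₁ := by
    rintro rfl
    obtain ⟨⟨a, -⟩, b, -⟩ := k2
    rcases fin2 d₂ with rfl | rfl <;> simp at a b <;> linarith
  by_cases h : d₄ = d₃
  · subst h
    clear k2 k5' k6'
    obtain ⟨⟨a, b⟩, c, d⟩ := k5
    obtain ⟨⟨a', b'⟩, c', d'⟩ := k6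
    rcases fin2 d₁ with rfl | rfl <;> rcases fin2 d₂ with rfl | rfl <;>
      rcases fin2 d₄ with rfl | rfl <;> rcases fin2 d₅ with rfl | rfl <;>
      rcases fin2 d₆ with rfl | rfl <;>
      simp only [ne_eq, not_true_eq_false, zero_ne_one, one_ne_zero, true_and, false_and, if_true,
        if_false, add_zero, zero_add] at * <;> linarith
  · clear k2 k5 k6
    obtain ⟨⟨a, b⟩, c, d⟩ := k5'
    obtain ⟨⟨a', b'⟩, c', d'⟩ := k6'
    rcases fin2 d₁ with rfl | rfl <;> rcases fin2 d₂ with rfl | rfl <;>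
      rcases fin2 d₃ with rfl | rfl <;> rcases fin2 d₄ with rfl | rfl <;>
      rcases fin2 d₅' with rfl | rfl <;> rcases fin2 d₆' with rfl | rfl <;>
      simp only [ne_eq, not_true_eq_false, zero_ne_one, one_ne_zero, true_and, false_and, if_true,
        if_false, add_zero, zero_add] at * <;> linarith

/-- **Lower bound for `OMSS(2,2)`.** Every deterministic online algorithm admits an instance
on which its makespan is at least `(9+√17)/8` times the optimum; consequently no deterministic
online algorithm for `OMSS(2,2)` is `r`-competitive for any `r < (9+√17)/8`. -/
theorem no_better_than_sqrt17_competitive :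
    (∀ A : OnlineAlg 2 2, ∃ I : OMSSInstance 2,
        ((9 + Real.sqrt 17) / 8) * OPT 2 I ≤ mkspan I (algAssign A I)) ∧
      ∀ r : ℝ, r < (9 + Real.sqrt 17) / 8 →
        ¬ ∃ A : OnlineAlg 2 2, ∀ I : OMSSInstance 2,
            mkspan I (algAssign A I) ≤ r * OPT 2 I := by
  refine ⟨fun A => ?_, ?_⟩
  · obtain ⟨I, -, hI⟩ := exists_OPT_pos_and_mul_OPT_le_mkspan A
    exact ⟨I, hI⟩
  · rintro r hr ⟨A, hA⟩
    obtain ⟨I, hpos, hI⟩ := exists_OPT_pos_and_mul_OPT_le_mkspan A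
    exact absurd (hI.trans (hA I)) (not_le.2 (mul_lt_mul_of_pos_right hr hpos))
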